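/- EVAL ⊊ MTT: every evaluation mapping eval_Σ can be realized by a macro tree transducer, and the inclusion of the class EVAL in the class MTT is strict, i.e., there is a macro tree transducer whose tree translation is not an evaluation mapping. -/

import Mathlib

set_option autoImplicit true
set_option maxHeartbeats 1000000

/-! ## XML forests (in first-child next-sibling style, also serving as binary XML trees) -/

/-- Node types: element, attribute, text nodes. -/
inductive NodeKind where
  | elem | attr | text
deriving DecidableEq, Repr

/-- Nonempty words over the universal alphabet `U` (= `Char`). -/
abbrev Word : Type := {w : List Char // w ≠ []}

/-- A node label: a type together with a name (a nonempty word over `U`). -/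
abbrev Label : Type := NodeKind × Word

/-- XML forests; `node l c r` is a tree with root label `l`, children forest `c`,
followed by the forest `r` of further trees of the sequence.  Under the
first-child next-sibling correspondence this type also represents binary XML
trees (with `eps` the ε-leaves and every labeled node binary), and the
encoding `fcns` is the identity of this representation. -/
inductive Forest where
  | eps : Forest
  | node : Label → Forest → Forest → Forest
deriving DecidableEq, Repr

namespace Forest

/-- Concatenation of forests. -/
def append : Forest → Forest → Forest
  | .eps, g => g
  | .node l c r, g => .node l c (append r g)

/-- The size of a forest = its number of nodes. -/
def size : Forest → ℕ
  | .eps => 0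
  | .node _ c r => 1 + c.size + r.size

/-- Height of a binary XML tree (length of the longest root-to-leaf path). -/
def height : Forest → ℕ
  | .eps => 0
  | .node _ c r => 1 + max c.height r.height

/-- All labels of the forest belong to `S`. -/
def labelsIn (S : Finset Label) : Forest → Prop
  | .eps => True
  | .node l c r => l ∈ S ∧ c.labelsIn S ∧ r.labelsIn S

end Forest

/-! ## Macro forest transducers -/

/-- Input variables: `x0` binds the current node together with the rest of the
stream, `x1` the children of the current node, `x2` the rest of the stream. -/
inductive XVar where
  | x0 | x1 | x2
deriving DecidableEq, Repr

def XVar.sel : XVar → Forest → Forest → Forest → Forest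
  | .x0, g0, _, _ => g0
  | .x1, _, g1, _ => g1
  | .x2, _, _, g2 => g2

/-- Right-hand sides of MFT rules: forests over `Σ ∪ Q ∪ {x0,x1,x2} ∪ Y`,
where a leaf is labeled by an input variable exactly if it is the first child of
a state-labeled node (constructor `call`), parameters occur only at leaves
(constructor `param`, with the remainder of the forest sequence), and `tnode`
is a `%t`-labeled node (only allowed in default rules). -/
inductive RHS (Q : Type) where
  | eps   : RHS Q
  | node  : Label → RHS Q → RHS Q → RHS Q
  | tnode : RHS Q → RHS Q → RHS Q
  | param : ℕ → RHS Q → RHS Q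
  | call  : Q → XVar → List (RHS Q) → RHS Q → RHS Q

namespace RHS

/-- Number of nodes of a right-hand side. -/
def size : RHS Q → ℕ
  | .eps => 0
  | .node _ c r => 1 + c.size + r.size
  | .tnode c r => 1 + c.size + r.size
  | .param _ r => 1 + r.size
  | .call _ _ args r => 1 + (args.attach.map (fun a => a.1.size)).sum + r.size
decreasing_by
  all_goals simp_wf
  all_goals try omega
  all_goals (have := List.sizeOf_lt_of_mem a.2; omega)


/-- Concatenation of right-hand-side forests. -/
def append : RHS Q → RHS Q → RHS Q
  | .eps, t => t
  | .node l c r, t => .node l c (r.append t)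
  | .tnode c r, t => .tnode c (r.append t)
  | .param j r, t => .param j (r.append t)
  | .call p x as r, t => .call p x as (r.append t)

mutual
/-- All calls in the right-hand side use only the input variable `x0`. -/
def varsOnly0 : RHS Q → Prop
  | .eps => True
  | .node _ c r => c.varsOnly0 ∧ r.varsOnly0
  | .tnode c r => c.varsOnly0 ∧ r.varsOnly0
  | .param _ r => r.varsOnly0
  | .call _ x args r => x = .x0 ∧ varsOnly0L args ∧ r.varsOnly0
def varsOnly0L : List (RHS Q) → Prop
  | [] => True
  | a :: as => a.varsOnly0 ∧ varsOnly0L as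
end

mutual
/-- No `%t`-labeled node occurs. -/
def noT : RHS Q → Prop
  | .eps => True
  | .node _ c r => c.noT ∧ r.noT
  | .tnode _ _ => False
  | .param _ r => r.noT
  | .call _ _ args r => noTL args ∧ r.noT
def noTL : List (RHS Q) → Prop
  | [] => True
  | a :: as => a.noT ∧ noTL as
end

mutual
/-- All labels of the right-hand side belong to `S`. -/
def labelsIn (S : Finset Label) : RHS Q → Prop
  | .eps => True
  | .node l c r => l ∈ S ∧ c.labelsIn S ∧ r.labelsIn S
  | .tnode c r => c.labelsIn S ∧ r.labelsIn S
  | .param _ r => r.labelsIn S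
  | .call _ _ args r => labelsInL S args ∧ r.labelsIn S
def labelsInL (S : Finset Label) : List (RHS Q) → Prop
  | [] => True
  | a :: as => a.labelsIn S ∧ labelsInL S as
end

mutual
/-- Ranks are respected: every state call `q` carries exactly `prm q` parameter
arguments and the parameters used are among `y₁,…,y_m`. -/
def arityOK (prm : Q → ℕ) (m : ℕ) : RHS Q → Prop
  | .eps => True
  | .node _ c r => c.arityOK prm m ∧ r.arityOK prm m
  | .tnode c r => c.arityOK prm m ∧ r.arityOK prm m
  | .param j r => j < m ∧ r.arityOK prm m
  | .call q _ args r => args.length = prm q ∧ arityOKL prm m args ∧ r.arityOK prm m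
def arityOKL (prm : Q → ℕ) (m : ℕ) : List (RHS Q) → Prop
  | [] => True
  | a :: as => a.arityOK prm m ∧ arityOKL prm m as
end

mutual
/-- No stay move: no call `q'(x₀)` occurs. -/
def noStay : RHS Q → Prop
  | .eps => True
  | .node _ c r => c.noStay ∧ r.noStay
  | .tnode c r => c.noStay ∧ r.noStay
  | .param _ r => r.noStay
  | .call _ x args r => x ≠ .x0 ∧ noStayL args ∧ r.noStay
def noStayL : List (RHS Q) → Prop
  | [] => True
  | a :: as => a.noStay ∧ noStayL as
end

mutual
/-- The right-hand side is a **tree** in which every labeled node is binary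
(reading `node l c r` as the binary node `l(c,r)`); parameters and state calls
occur as leaves of this tree (empty continuation). -/
def isTree : RHS Q → Prop
  | .eps => True
  | .node _ c r => c.isTree ∧ r.isTree
  | .tnode c r => c.isTree ∧ r.isTree
  | .param _ r => r = .eps
  | .call _ _ args r => isTreeL args ∧ r = .eps
def isTreeL : List (RHS Q) → Prop
  | [] => True
  | a :: as => a.isTree ∧ isTreeL as
end

end RHS

/-- A macro forest transducer (MFT) over the finite set `sig ⊆ U⁺` of symbols:
a finite ranked set `Q` of states (state `q` has `prm q` accumulating
parameters, i.e. rank `prm q + 1`), an initial state `q0` of rank 1, and for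
every state at most one `(q,σ)`-rule per symbol `σ ∈ sig`, exactly one ε-rule
and exactly one default rule. -/
structure MFT where
  Q : Type
  [fintypeQ : Fintype Q]
  [deceqQ : DecidableEq Q]
  prm : Q → ℕ
  q0 : Q
  sig : Finset Label
  ruleSym : Q → Label → Option (RHS Q)
  ruleEps : Q → RHS Q
  ruleDef : Q → RHS Q

attribute [instance] MFT.fintypeQ MFT.deceqQ

/-- Well-formedness of an MFT, as required by the definition: the initial state
has rank 1; `(q,σ)`-rules only for `σ ∈ sig`; `(q,σ)`-rules contain no `%t`;
ε-rules contain no `%t` and use only the input variable `x0`; all labels in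
right-hand sides are symbols of `sig`; all rules respect the ranks of states. -/
def MFT.WF (M : MFT) : Prop :=
  M.prm M.q0 = 0 ∧
  (∀ q a, a ∉ M.sig → M.ruleSym q a = none) ∧
  (∀ q a r, M.ruleSym q a = some r →
      r.noT ∧ r.labelsIn M.sig ∧ r.arityOK M.prm (M.prm q)) ∧
  (∀ q : M.Q, (M.ruleEps q).noT ∧ (M.ruleEps q).varsOnly0 ∧
      (M.ruleEps q).labelsIn M.sig ∧ (M.ruleEps q).arityOK M.prm (M.prm q)) ∧
  (∀ q : M.Q, (M.ruleDef q).labelsIn M.sig ∧ (M.ruleDef q).arityOK M.prm (M.prm q))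

mutual
/-- Big-step semantics of states: `Eval M q g ys out` means
`⟦q⟧(g, ys) = out`: the unique applicable rule of `q` on input `g` is chosen
(the ε-rule if `g = ε`, the `(q,σ)`-rule if `g = σ(g₁)g₂` and it exists,
otherwise the default rule) and its right-hand side evaluated. -/
inductive Eval (M : MFT) : M.Q → Forest → List Forest → Forest → Prop where
  | eps : ∀ (q : M.Q) (ys : List Forest) (out : Forest),
      EvalR M (M.ruleEps q) .eps .eps .eps none ys out →
      Eval M q .eps ys out
  | sym : ∀ (q : M.Q) (l : Label) (c r : Forest) (rh : RHS M.Q) ys out,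
      M.ruleSym q l = some rh →
      EvalR M rh (.node l c r) c r (some l) ys out →
      Eval M q (.node l c r) ys out
  | dflt : ∀ (q : M.Q) (l : Label) (c r : Forest) ys out,
      M.ruleSym q l = none →
      EvalR M (M.ruleDef q) (.node l c r) c r (some l) ys out →
      Eval M q (.node l c r) ys out

/-- Evaluation of right-hand sides: `EvalR M rh g0 g1 g2 lab ys out`; here `g0`
is bound to `x0`, `g1` to `x1`, `g2` to `x2`, `lab` is the label of the current
node (for `%t`-nodes), and `ys` are the values of the parameters. -/
inductive EvalR (M : MFT) : RHS M.Q → Forest → Forest → Forest → Option Label →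
    List Forest → Forest → Prop where
  | eps : ∀ g0 g1 g2 lab ys, EvalR M .eps g0 g1 g2 lab ys .eps
  | node : ∀ (l : Label) c r g0 g1 g2 lab ys oc orr,
      EvalR M c g0 g1 g2 lab ys oc → EvalR M r g0 g1 g2 lab ys orr →
      EvalR M (.node l c r) g0 g1 g2 lab ys (.node l oc orr)
  | tnode : ∀ (l : Label) c r g0 g1 g2 ys oc orr,
      EvalR M c g0 g1 g2 (some l) ys oc → EvalR M r g0 g1 g2 (some l) ys orr →
      EvalR M (.tnode c r) g0 g1 g2 (some l) ys (.node l oc orr)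
  | param : ∀ (j : ℕ) r g0 g1 g2 lab ys orr,
      EvalR M r g0 g1 g2 lab ys orr →
      EvalR M (.param j r) g0 g1 g2 lab ys ((ys.getD j .eps).append orr)
  | call : ∀ (p : M.Q) (x : XVar) args cont g0 g1 g2 lab ys vs oq orr,
      EvalL M args g0 g1 g2 lab ys vs →
      Eval M p (x.sel g0 g1 g2) vs oq →
      EvalR M cont g0 g1 g2 lab ys orr →
      EvalR M (.call p x args cont) g0 g1 g2 lab ys (oq.append orr)

/-- Pointwise evaluation of the parameter-argument list of a state call. -/
inductive EvalL (M : MFT) : List (RHS M.Q) → Forest → Forest → Forest →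
    Option Label → List Forest → List Forest → Prop where
  | nil : ∀ g0 g1 g2 lab ys, EvalL M [] g0 g1 g2 lab ys []
  | cons : ∀ a as g0 g1 g2 lab ys v vs,
      EvalR M a g0 g1 g2 lab ys v → EvalL M as g0 g1 g2 lab ys vs →
      EvalL M (a :: as) g0 g1 g2 lab ys (v :: vs)
end

/-- The translation realized by `M`: `⟦M⟧(f) = ⟦q₀⟧(f)` (as a binary relation;
for terminating MFTs this relation is a total function). -/
def MFT.Sem (M : MFT) : Forest → Forest → Prop :=
  fun f g => Eval M M.q0 f [] g

/-- `M` is terminating: every state on every input with every parameter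
assignment produces exactly one output. -/
def MFT.Terminating (M : MFT) : Prop :=
  ∀ (q : M.Q) (f : Forest) (ys : List Forest), ∃! out, Eval M q f ys out

/-- Size of a transducer: `|sig|` plus the sum of the sizes of all left-hand
sides and right-hand sides of its rules. -/
def MFT.size (M : MFT) : ℕ :=
  M.sig.card +
    ∑ q : M.Q, ((M.prm q + 2) + (M.ruleEps q).size
      + ((M.prm q + 4) + (M.ruleDef q).size)
      + ∑ a ∈ M.sig, ((M.ruleSym q a).elim 0 fun r => (M.prm q + 4) + r.size))

/-- A forest transducer (FT): an MFT all of whose states have rank 1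
(no accumulating parameters). -/
def MFT.IsFT (M : MFT) : Prop := ∀ q : M.Q, M.prm q = 0

/-- A macro tree transducer (MTT): an MFT whose rule right-hand sides are trees
in which every `Σ∪{%t}`-labeled node is binary. -/
def MFT.IsMTT (M : MFT) : Prop :=
  (∀ q a r, M.ruleSym q a = some r → r.isTree) ∧
  (∀ q : M.Q, (M.ruleEps q).isTree ∧ (M.ruleDef q).isTree)

/-- A top-down tree transducer (TT): an FT that is an MTT. -/
def MFT.IsTT (M : MFT) : Prop := M.IsFT ∧ M.IsMTT

/-- `M` contains no stay moves. -/
def MFT.NoStay (M : MFT) : Prop :=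
  (∀ q a r, M.ruleSym q a = some r → r.noStay) ∧
  (∀ q : M.Q, (M.ruleEps q).noStay ∧ (M.ruleDef q).noStay)

/-- Composition of translations (apply `T1` first, then `T2`). -/
def TransComp (T1 T2 : Forest → Forest → Prop) : Forest → Forest → Prop :=
  fun f g => ∃ h, T1 f h ∧ T2 h g

/-! ## Classes of (binary) tree translations -/

/-- Under the first-child next-sibling representation used here, forests are
represented by their binary XML trees, so the encoding `fcns`
(`fcns(ε)=ε`, `fcns(σ(f₁)f₂)=σ(fcns f₁, fcns f₂)`) is realized by the identity
on the representation. -/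
def fcns : Forest → Forest
  | .eps => .eps
  | .node l c r => .node l (fcns c) (fcns r)

/-- The class of binary tree translations of all (terminating) MFTs. -/
def MFTclass : Set (Forest → Forest → Prop) :=
  {T | ∃ M : MFT, M.WF ∧ M.Terminating ∧ T = fun f g => M.Sem f g}

/-- The class of tree translations of all (terminating) MTTs. -/
def MTTclass : Set (Forest → Forest → Prop) :=
  {T | ∃ M : MFT, M.WF ∧ M.Terminating ∧ M.IsMTT ∧ T = fun f g => M.Sem f g}

/-- The class of binary tree translations of all (terminating) FTs. -/
def FTclass : Set (Forest → Forest → Prop) :=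
  {T | ∃ M : MFT, M.WF ∧ M.Terminating ∧ M.IsFT ∧ T = fun f g => M.Sem f g}

/-- The class of tree translations of all (terminating) TTs. -/
def TTclass : Set (Forest → Forest → Prop) :=
  {T | ∃ M : MFT, M.WF ∧ M.Terminating ∧ M.IsTT ∧ T = fun f g => M.Sem f g}

/-- The evaluation mapping `eval_Σ` with distinguished binary symbol `@` (here
`d`): it interprets `d`-labeled binary nodes as forest concatenation and acts
as the identity on all other labels. -/
def evalMap (d : Label) : Forest → Forest
  | .eps => .eps
  | .node l c r =>
      if l = d then (evalMap d c).append (evalMap d r)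
      else .node l (evalMap d c) (evalMap d r)

/-- The translation (graph) of the evaluation mapping `eval` with
distinguished symbol `d`. -/
def evalTrans (d : Label) : Forest → Forest → Prop := fun f g => g = evalMap d f

/-- The class `EVAL` of all evaluation mappings. -/
def EVALclass : Set (Forest → Forest → Prop) :=
  {T | ∃ d : Label, T = evalTrans d}

/-- Composition of classes of translations:
`F ∘ G = { f ∘ g : f ∈ F, g ∈ G }` (apply a member of `F` first). -/
def classComp (F G : Set (Forest → Forest → Prop)) : Set (Forest → Forest → Prop) :=
  {T | ∃ t1 ∈ F, ∃ t2 ∈ G, T = TransComp t1 t2}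

theorem Forest.append_eps (f : Forest) : f.append .eps = f := by
  induction f with
  | eps => rfl
  | node l c r _ ihr => simp [Forest.append, ihr]

theorem Forest.append_assoc (f g h : Forest) :
    (f.append g).append h = f.append (g.append h) := by
  induction f with
  | eps => rfl
  | node l c r _ ihr => simp [Forest.append, ihr]

section Inversion

variable {M : MFT} {g0 g1 g2 : Forest} {lab : Option Label} {ys : List Forest}

theorem eval_eps_iff {q : M.Q} {out : Forest} :
    Eval M q .eps ys out ↔ EvalR M (M.ruleEps q) .eps .eps .eps none ys out :=
  ⟨fun h => by cases h; assumption, fun h => .eps _ _ _ h⟩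

theorem eval_node_iff {q : M.Q} {l : Label} {c r out : Forest} :
    Eval M q (.node l c r) ys out ↔
      EvalR M ((M.ruleSym q l).getD (M.ruleDef q)) (.node l c r) c r (some l) ys out := by
  constructor
  · intro h
    cases h <;> simp_all
  · intro h
    cases hr : M.ruleSym q l with
    | none => exact .dflt _ _ _ _ _ _ hr (by simpa [hr] using h)
    | some rh => exact .sym _ _ _ _ rh _ _ hr (by simpa [hr] using h)

theorem evalR_eps_iff {out : Forest} :
    EvalR M .eps g0 g1 g2 lab ys out ↔ out = .eps :=
  ⟨fun h => by cases h; rfl, fun h => h ▸ .eps _ _ _ _ _⟩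

theorem evalR_tnode_iff {l : Label} {c r : RHS M.Q} {out : Forest} :
    EvalR M (.tnode c r) g0 g1 g2 (some l) ys out ↔
      ∃ oc orr, EvalR M c g0 g1 g2 (some l) ys oc ∧ EvalR M r g0 g1 g2 (some l) ys orr ∧
        out = .node l oc orr := by
  constructor
  · intro h
    cases h
    exact ⟨_, _, ‹_›, ‹_›, rfl⟩
  · rintro ⟨oc, orr, hc, hr, rfl⟩
    exact .tnode _ _ _ _ _ _ _ _ _ hc hr

theorem evalR_param_iff {j : ℕ} {r : RHS M.Q} {out : Forest} :
    EvalR M (.param j r) g0 g1 g2 lab ys out ↔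
      ∃ orr, EvalR M r g0 g1 g2 lab ys orr ∧ out = (ys.getD j .eps).append orr := by
  constructor
  · intro h
    cases h
    exact ⟨_, ‹_›, rfl⟩
  · rintro ⟨orr, hr, rfl⟩
    exact .param _ _ _ _ _ _ _ _ hr

theorem evalR_call_iff {p : M.Q} {x : XVar} {args : List (RHS M.Q)} {cont : RHS M.Q}
    {out : Forest} :
    EvalR M (.call p x args cont) g0 g1 g2 lab ys out ↔
      ∃ vs oq orr, EvalL M args g0 g1 g2 lab ys vs ∧ Eval M p (x.sel g0 g1 g2) vs oq ∧
        EvalR M cont g0 g1 g2 lab ys orr ∧ out = oq.append orr := by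
  constructor
  · intro h
    cases h
    exact ⟨_, _, _, ‹_›, ‹_›, ‹_›, rfl⟩
  · rintro ⟨vs, oq, orr, ha, hp, hr, rfl⟩
    exact .call _ _ _ _ _ _ _ _ _ _ _ _ ha hp hr

theorem evalL_nil_iff {vs : List Forest} :
    EvalL M [] g0 g1 g2 lab ys vs ↔ vs = [] :=
  ⟨fun h => by cases h; rfl, fun h => h ▸ .nil _ _ _ _ _⟩

theorem evalL_cons_iff {a : RHS M.Q} {as : List (RHS M.Q)} {vs : List Forest} :
    EvalL M (a :: as) g0 g1 g2 lab ys vs ↔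
      ∃ v ws, EvalR M a g0 g1 g2 lab ys v ∧ EvalL M as g0 g1 g2 lab ys ws ∧ vs = v :: ws := by
  constructor
  · intro h
    cases h
    exact ⟨_, _, ‹_›, ‹_›, rfl⟩
  · rintro ⟨v, ws, ha, has, rfl⟩
    exact .cons _ _ _ _ _ _ _ _ _ ha has

end Inversion

/-- The macro tree transducer realizing `evalMap d`. The state `false` evaluates its input;
the state `true` evaluates its input and appends its parameter to the result. -/
def evalMTT (d : Label) : MFT where
  Q := Bool
  prm q := if q then 1 else 0
  q0 := false
  sig := {d}
  ruleSym q l :=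
    if l = d then
      some (if q then .call true .x1 [.call true .x2 [.param 0 .eps] .eps] .eps
        else .call true .x1 [.call false .x2 [] .eps] .eps)
    else none
  ruleEps q := if q then .param 0 .eps else .eps
  ruleDef q :=
    if q then .tnode (.call false .x1 [] .eps) (.call true .x2 [.param 0 .eps] .eps)
    else .tnode (.call false .x1 [] .eps) (.call false .x2 [] .eps)

/-- In any transducer, two states with the rules of `evalMTT d` compute `evalMap d`, without and
with an accumulating parameter. -/
theorem eval_iff_of_rules {M : MFT} {d : Label} {p q : M.Q}
    (hpe : M.ruleEps p = .eps) (hqe : M.ruleEps q = .param 0 .eps)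
    (hps : ∀ l, M.ruleSym p l =
      if l = d then some (.call q .x1 [.call p .x2 [] .eps] .eps) else none)
    (hqs : ∀ l, M.ruleSym q l =
      if l = d then some (.call q .x1 [.call q .x2 [.param 0 .eps] .eps] .eps) else none)
    (hpd : M.ruleDef p = .tnode (.call p .x1 [] .eps) (.call p .x2 [] .eps))
    (hqd : M.ruleDef q = .tnode (.call p .x1 [] .eps) (.call q .x2 [.param 0 .eps] .eps))
    (f : Forest) :
    (∀ ys out, Eval M p f ys out ↔ out = evalMap d f) ∧
    (∀ ys out, Eval M q f ys out ↔ out = (evalMap d f).append (ys.getD 0 .eps)) := by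
  induction f with
  | eps =>
    constructor <;> intro ys out <;> rw [eval_eps_iff]
    · simp [hpe, evalR_eps_iff, evalMap]
    · simp [hqe, evalR_param_iff, evalR_eps_iff, evalMap, Forest.append, Forest.append_eps]
  | node l c r ihc ihr =>
    constructor <;> intro ys out <;> rw [eval_node_iff] <;> by_cases hl : l = d <;>
      simp [hl, hps, hqs, hpd, hqd, evalMap, evalR_call_iff, evalR_tnode_iff, evalR_param_iff,
        evalR_eps_iff, evalL_nil_iff, evalL_cons_iff, XVar.sel, ihc.1, ihc.2, ihr.1, ihr.2,
        Forest.append, Forest.append_eps, Forest.append_assoc]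

theorem evalMTT_eval_iff (d : Label) (f : Forest) :
    (∀ ys out, Eval (evalMTT d) (false : Bool) f ys out ↔ out = evalMap d f) ∧
    (∀ ys out, Eval (evalMTT d) (true : Bool) f ys out ↔
      out = (evalMap d f).append (ys.getD 0 .eps)) :=
  eval_iff_of_rules (M := evalMTT d) rfl rfl (fun _ => rfl) (fun _ => rfl) rfl rfl f

theorem evalMTT_wf (d : Label) : (evalMTT d).WF := by
  refine ⟨rfl, ?_, ?_, ?_, ?_⟩
  · intro q a ha
    simpa [evalMTT] using ha
  · intro q a r h
    by_cases ha : a = d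
    · subst ha
      cases q <;> simp [evalMTT] at h <;> obtain rfl := Option.some.inj h <;>
        simp [RHS.noT, RHS.noTL, RHS.labelsIn, RHS.labelsInL, RHS.arityOK, RHS.arityOKL]
      exacts [⟨rfl, rfl⟩, ⟨rfl, rfl, Nat.one_pos⟩]
    · simp [evalMTT, ha] at h
  · rintro (_ | _) <;>
      simp [evalMTT, RHS.noT, RHS.varsOnly0, RHS.labelsIn, RHS.arityOK]
  · rintro (_ | _) <;>
      simp [evalMTT, RHS.labelsIn, RHS.labelsInL, RHS.arityOK, RHS.arityOKL]

theorem evalMTT_isMTT (d : Label) : (evalMTT d).IsMTT := by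
  constructor
  · intro q a r h
    by_cases ha : a = d
    · cases q <;> simp [evalMTT, ha] at h <;> obtain rfl := Option.some.inj h <;>
        simp [RHS.isTree, RHS.isTreeL] <;> rfl
    · simp [evalMTT, ha] at h
  · rintro (_ | _) <;> simp [evalMTT, RHS.isTree, RHS.isTreeL]

theorem evalMTT_terminating (d : Label) : (evalMTT d).Terminating := by
  rintro (_ | _) f ys
  · exact ⟨_, ((evalMTT_eval_iff d f).1 ys _).2 rfl, fun _ h => ((evalMTT_eval_iff d f).1 ys _).1 h⟩
  · exact ⟨_, ((evalMTT_eval_iff d f).2 ys _).2 rfl, fun _ h => ((evalMTT_eval_iff d f).2 ys _).1 h⟩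

theorem evalMTT_sem (d : Label) : (evalMTT d).Sem = evalTrans d := by
  funext f g
  exact propext ((evalMTT_eval_iff d f).1 [] g)

/-- A macro tree transducer erasing every input. -/
def eraseMTT : MFT where
  Q := Unit
  prm _ := 0
  q0 := ()
  sig := ∅
  ruleSym _ _ := none
  ruleEps _ := .eps
  ruleDef _ := .eps

theorem eraseMTT_eval_iff (q : eraseMTT.Q) (f : Forest) (ys : List Forest) (out : Forest) :
    Eval eraseMTT q f ys out ↔ out = .eps := by
  cases f with
  | eps => exact eval_eps_iff.trans evalR_eps_iff
  | node l c r => exact eval_node_iff.trans evalR_eps_iff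

theorem eraseMTT_wf : eraseMTT.WF := by
  simp [MFT.WF, eraseMTT, RHS.noT, RHS.varsOnly0, RHS.labelsIn, RHS.arityOK]

theorem eraseMTT_isMTT : eraseMTT.IsMTT := by
  simp [MFT.IsMTT, eraseMTT, RHS.isTree]

theorem eraseMTT_terminating : eraseMTT.Terminating := fun q f ys =>
  ⟨.eps, (eraseMTT_eval_iff q f ys _).2 rfl, fun _ h => (eraseMTT_eval_iff q f ys _).1 h⟩

theorem eraseMTT_sem_notMem_EVALclass : eraseMTT.Sem ∉ EVALclass := by
  rintro ⟨d, hd⟩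
  obtain ⟨l, hl⟩ : ∃ l : Label, l ≠ d :=
    ⟨(if d.1 = .elem then .attr else .elem, d.2), fun h => by
      have := congrArg Prod.fst h
      split_ifs at this <;> simp_all⟩
  have h : evalTrans d (.node l .eps .eps) .eps := by
    rw [← hd]
    exact (eraseMTT_eval_iff _ _ _ _).2 rfl
  simp [evalTrans, evalMap, hl] at h

/-- `EVAL ⊊ MTT`: every evaluation mapping `eval_Σ` can be
realized by a macro tree transducer, and the inclusion of the class `EVAL` in
the class `MTT` is strict, i.e. there is a macro tree transducer whose tree
translation is not an evaluation mapping. -/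
theorem eval_ssubset_mtt :
    (∀ d : Label, ∃ M : MFT, M.WF ∧ M.Terminating ∧ M.IsMTT ∧
        M.Sem = evalTrans d) ∧
    EVALclass ⊂ MTTclass := by
  refine ⟨fun d => ⟨evalMTT d, evalMTT_wf d, evalMTT_terminating d, evalMTT_isMTT d,
    evalMTT_sem d⟩, ?_, fun h => eraseMTT_sem_notMem_EVALclass
      (h ⟨eraseMTT, eraseMTT_wf, eraseMTT_terminating, eraseMTT_isMTT, rfl⟩)⟩
  rintro _ ⟨d, rfl⟩
  exact ⟨evalMTT d, evalMTT_wf d, evalMTT_terminating d, evalMTT_isMTT d, (evalMTT_sem d).symm⟩
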